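/- arXiv:1507.01704 — 2 statements merged into one kernel-verified Lean document; each statement's English description precedes it below -/
import Mathlib

section
/- Let U, V ⊆ ℂ be nonempty open sets with V connected, and let f : U → V be holomorphic such that f′(z) ≠ 0 for all z ∈ U and f has no asymptotic curves, i.e., for every curve γ : [0,1) → U that eventually leaves every compact subset of U, the limit lim_{t→1} f(γ(t)) does not exist as a point of V. Then f : U → V is a covering map. -/
open Complex Filter Topology

section PathLifting

open Set

variable {E X : Type*} [TopologicalSpace E] {p : E → X}

/-- `Γ` lifts `γ` through `p` on `[0, t]`, starting at `e`. -/
structure IsLiftOnIcc (p : E → X) (γ : ℝ → X) (e : E) (t : ℝ) (Γ : ℝ → E) : Prop where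
  continuousOn : ContinuousOn Γ (Icc 0 t)
  map_zero : Γ 0 = e
  lifts : ∀ s ∈ Icc 0 t, p (Γ s) = γ s

namespace IsLiftOnIcc

variable {γ : ℝ → X} {e : E} {s t : ℝ} {Γ Γ' : ℝ → E}

theorem mono (h : IsLiftOnIcc p γ e t Γ) (hst : s ≤ t) : IsLiftOnIcc p γ e s Γ where
  continuousOn := h.continuousOn.mono (Icc_subset_Icc_right hst)
  map_zero := h.map_zero
  lifts r hr := h.lifts r (Icc_subset_Icc_right hst hr)

variable [TopologicalSpace X]

theorem eqOn (hp : IsLocalHomeomorph p) (sep : IsSeparatedMap p) (h : IsLiftOnIcc p γ e t Γ)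
    (h' : IsLiftOnIcc p γ e t Γ') (ht : 0 ≤ t) : EqOn Γ Γ' (Icc 0 t) :=
  sep.eqOn_of_comp_eqOn hp.isLocallyInjective isPreconnected_Icc h.continuousOn h'.continuousOn
    (fun r hr ↦ (h.lifts r hr).trans (h'.lifts r hr).symm) (left_mem_Icc.2 ht)
    (h.map_zero.trans h'.map_zero.symm)

/-- A lift on `[0, s]` ending in the source of a local inverse whose domain contains `γ` on `[s, t]`
extends to `[0, t]`. -/
theorem exists_extend (q : OpenPartialHomeomorph E X) (hq : ⇑q = p) (hγ : Continuous γ)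
    (h : IsLiftOnIcc p γ e s Γ) (hs : 0 ≤ s) (hst : s ≤ t) (hsource : Γ s ∈ q.source)
    (htarget : ∀ r ∈ Icc s t, γ r ∈ q.target) : ∃ Γ', IsLiftOnIcc p γ e t Γ' := by
  subst hq
  classical
  refine ⟨fun r ↦ if r ≤ s then Γ r else q.symm (γ r), ?_, ?_, ?_⟩
  · rw [← Icc_union_Icc_eq_Icc hs hst]
    refine ContinuousOn.union_of_isClosed ?_ ?_ isClosed_Icc isClosed_Icc
    · exact h.continuousOn.congr fun r hr ↦ if_pos hr.2
    · refine (q.continuousOn_symm.comp hγ.continuousOn htarget).congr fun r hr ↦ ?_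
      split_ifs with hrs
      · obtain rfl : r = s := le_antisymm hrs hr.1
        simp [← h.lifts r ⟨hs, le_rfl⟩, q.left_inv hsource]
      · rfl
  · simp [hs, h.map_zero]
  · intro r hr
    split_ifs with hrs
    · exact h.lifts r ⟨hr.1, hrs⟩
    · exact q.right_inv (htarget r ⟨(not_le.1 hrs).le, hr.2⟩)

theorem exists_glue (hp : IsLocalHomeomorph p) (sep : IsSeparatedMap p)
    (h : ∀ s, 0 ≤ s → s < t → ∃ Γ, IsLiftOnIcc p γ e s Γ) :
    ∃ Γ, ContinuousOn Γ (Ico 0 t) ∧ ∀ s, 0 ≤ s → s < t → IsLiftOnIcc p γ e s Γ := by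
  have : Nonempty E := ⟨e⟩
  choose! Λ hΛ using h
  have key : ∀ s, 0 ≤ s → s < t → EqOn (fun r ↦ Λ r r) (Λ s) (Icc 0 s) := fun s h0 hs r hr ↦
    (hΛ r hr.1 (hr.2.trans_lt hs)).eqOn hp sep ((hΛ s h0 hs).mono hr.2) hr.1 (right_mem_Icc.2 hr.1)
  have lift : ∀ s, 0 ≤ s → s < t → IsLiftOnIcc p γ e s (fun r ↦ Λ r r) := fun s h0 hs ↦
    { continuousOn := (hΛ s h0 hs).continuousOn.congr (key s h0 hs)
      map_zero := (key s h0 hs (left_mem_Icc.2 h0)).trans (hΛ s h0 hs).map_zero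
      lifts := fun r hr ↦ (congr_arg p (key s h0 hs hr)).trans ((hΛ s h0 hs).lifts r hr) }
  refine ⟨_, fun r hr ↦ ?_, lift⟩
  obtain ⟨s, hrs, hst⟩ := exists_between hr.2
  refine ((lift s (hr.1.trans hrs.le) hst).continuousOn r ⟨hr.1, hrs.le⟩).mono_of_mem_nhdsWithin ?_
  filter_upwards [self_mem_nhdsWithin, mem_nhdsWithin_of_mem_nhds (Iio_mem_nhds hrs)] with u hu hu'
  exact ⟨hu.1, le_of_lt hu'⟩

end IsLiftOnIcc

/-- A separated local homeomorphism lifts paths as soon as every half-open curve upstairs whose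
image converges has a cluster point. -/
theorem IsLocalHomeomorph.exists_path_lift_of_mapClusterPt [TopologicalSpace X] [T2Space X]
    (hp : IsLocalHomeomorph p) (sep : IsSeparatedMap p)
    (hcluster : ∀ Γ : ℝ → E, ContinuousOn Γ (Ico 0 1) → ∀ x, Tendsto (p ∘ Γ) (𝓝[<] 1) (𝓝 x) →
      ∃ w, MapClusterPt w (𝓝[<] 1) Γ)
    (γ : C(unitInterval, X)) (e : E) (he : p e = γ 0) :
    ∃ Γ : C(unitInterval, E), Γ 0 = e ∧ p ∘ Γ = γ := by
  let γ' : ℝ → X := IccExtend zero_le_one γ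
  have hγ' : Continuous γ' := γ.continuous.Icc_extend'
  have zero : IsLiftOnIcc p γ' e 0 (fun _ ↦ e) :=
    { continuousOn := continuousOn_const
      map_zero := rfl
      lifts := fun s hs ↦ by
        obtain rfl : s = 0 := le_antisymm hs.2 hs.1
        rw [he]; exact (IccExtend_left zero_le_one γ).symm }
  have limit : ∀ t, 0 < t → (∀ s, 0 ≤ s → s < t → ∃ Γ, IsLiftOnIcc p γ' e s Γ) →
      ∃ Γ, IsLiftOnIcc p γ' e t Γ := by
    intro t ht h
    obtain ⟨Γ, hΓ, hlift⟩ := IsLiftOnIcc.exists_glue hp sep h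
    have hpos : ∀ᶠ s in 𝓝[<] t, 0 ≤ s ∧ s < t := by
      filter_upwards [self_mem_nhdsWithin, mem_nhdsWithin_of_mem_nhds (Ioi_mem_nhds ht)] with s h1 h2
      exact ⟨le_of_lt h2, h1⟩
    have hlim : Tendsto (p ∘ Γ) (𝓝[<] t) (𝓝 (γ' t)) := by
      refine (hγ'.continuousAt.mono_left nhdsWithin_le_nhds).congr' ?_
      filter_upwards [hpos] with s hs
      exact ((hlift s hs.1 hs.2).lifts s ⟨hs.1, le_rfl⟩).symm
    have hscale : Tendsto (fun s ↦ t * s) (𝓝[<] 1) (𝓝[<] t) := by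
      refine tendsto_nhdsWithin_iff.2 ⟨?_, ?_⟩
      · have : Continuous fun s : ℝ ↦ t * s := by fun_prop
        simpa using (this.tendsto 1).mono_left nhdsWithin_le_nhds
      · filter_upwards [self_mem_nhdsWithin] with s hs
        exact mul_lt_of_lt_one_right ht hs
    obtain ⟨w, hw⟩ := hcluster (fun s ↦ Γ (t * s))
      (hΓ.comp (by fun_prop) fun s hs ↦
        ⟨mul_nonneg ht.le hs.1, mul_lt_of_lt_one_right ht hs.2⟩) _ (hlim.comp hscale)
    have hw : MapClusterPt w (𝓝[<] t) Γ := (mapClusterPt_comp.1 hw).mono hscale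
    have hpw : p w = γ' t := by
      by_contra hne
      have hd := disjoint_nhds_nhds.2 hne
      have := hw.continuousAt_comp hp.continuous.continuousAt
      exact (this.clusterPt.mono hlim).neBot.ne (disjoint_iff.1 hd)
    obtain ⟨q, hwq, rfl⟩ := hp w
    have htarget : ∀ᶠ s in 𝓝 t, γ' s ∈ q.target :=
      hγ'.continuousAt.eventually (q.open_target.mem_nhds (hpw ▸ q.map_source hwq))
    obtain ⟨δ, hδ, hball⟩ := Metric.eventually_nhds_iff_ball.1 htarget
    obtain ⟨s, hs, hs0, hδs⟩ := ((hw.frequently (q.open_source.mem_nhds hwq)).and_eventually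
      (hpos.and (mem_nhdsWithin_of_mem_nhds (Ioi_mem_nhds (sub_lt_self t hδ))))).exists
    refine (hlift s hs0.1 hs0.2).exists_extend q rfl hγ' hs0.1 hs0.2.le hs fun r hr ↦ hball r ?_
    rw [Metric.mem_ball, Real.dist_eq, abs_lt]
    have : t - δ < s := hδs
    constructor <;> linarith [hr.1, hr.2]
  have extend : ∀ t, 0 ≤ t → (∃ Γ, IsLiftOnIcc p γ' e t Γ) →
      ∃ t' > t, ∃ Γ, IsLiftOnIcc p γ' e t' Γ := by
    rintro t ht ⟨Γ, hΓ⟩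
    obtain ⟨q, hq, rfl⟩ := hp (Γ t)
    have htarget : ∀ᶠ s in 𝓝 t, γ' s ∈ q.target :=
      hγ'.continuousAt.eventually (q.open_target.mem_nhds
        (hΓ.lifts t ⟨ht, le_rfl⟩ ▸ q.map_source hq))
    obtain ⟨δ, hδ, hball⟩ := Metric.eventually_nhds_iff_ball.1 htarget
    refine ⟨t + δ / 2, by linarith, hΓ.exists_extend q rfl hγ' ht (by linarith) hq fun r hr ↦
      hball r ?_⟩
    rw [Metric.mem_ball, Real.dist_eq, abs_lt]
    constructor <;> linarith [hr.1, hr.2]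
  obtain ⟨Γ, hΓ⟩ : ∃ Γ, IsLiftOnIcc p γ' e 1 Γ := by
    by_contra hone
    let S : Set ℝ := {t | 0 ≤ t ∧ ∃ Γ, IsLiftOnIcc p γ' e t Γ}
    have hS0 : (0 : ℝ) ∈ S := ⟨le_rfl, _, zero⟩
    have hSbdd : BddAbove S := ⟨1, fun t ht ↦ by
      by_contra! hlt
      exact hone (ht.2.imp fun _ h ↦ h.mono hlt.le)⟩
    have hbelow : ∀ s, 0 ≤ s → s < sSup S → ∃ Γ, IsLiftOnIcc p γ' e s Γ := fun s _ hs ↦ by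
      obtain ⟨t, ht, hst⟩ := exists_lt_of_lt_csSup ⟨0, hS0⟩ hs
      exact ht.2.imp fun _ h ↦ h.mono hst.le
    have hsup : 0 ≤ sSup S := le_csSup hSbdd hS0
    have hmem : ∃ Γ, IsLiftOnIcc p γ' e (sSup S) Γ := by
      rcases hsup.eq_or_lt with h | h
      · rw [← h]; exact ⟨_, zero⟩
      · exact limit _ h hbelow
    obtain ⟨t, ht, hlift⟩ := extend _ hsup hmem
    exact ht.not_ge (le_csSup hSbdd ⟨hsup.trans ht.le, hlift⟩)
  refine ⟨⟨fun s ↦ Γ s, hΓ.continuousOn.comp_continuous continuous_subtype_val fun s ↦ s.2⟩,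
    hΓ.map_zero, funext fun s ↦ (hΓ.lifts s s.2).trans (IccExtend_val zero_le_one γ s)⟩

end PathLifting

section LocalSections

variable {E X : Type*} [TopologicalSpace E] [TopologicalSpace X] {p : E → X}

/-- A separated local homeomorphism with nonempty fiber over `x` evenly covers `x` if there is a
continuous section over a fixed connected open neighborhood of `x` through every point above it. -/
theorem IsLocalHomeomorph.isEvenlyCovered_of_exists_section (hp : IsLocalHomeomorph p)
    (sep : IsSeparatedMap p) {x : X} {B : Set X} (hB : IsOpen B) (hBc : IsPreconnected B)
    (hx : x ∈ B) (hne : (p ⁻¹' {x}).Nonempty)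
    (hsec : ∀ e, ∀ he : p e ∈ B, ∃ s : B → E, Continuous s ∧ (∀ y, p (s y) = y) ∧
      s ⟨p e, he⟩ = e) :
    IsEvenlyCovered p x (p ⁻¹' {x}) := by
  have : PreconnectedSpace B := isPreconnected_iff_preconnectedSpace.1 hBc
  have hdisc : DiscreteTopology (p ⁻¹' {x}) :=
    (IsDiscrete.of_openPartialHomeomorph p subset_rfl fun e _ ↦
      (hp e).imp fun _ h ↦ ⟨h.1, h.2.symm⟩).1
  have : Nonempty (p ⁻¹' {x}) := hne.to_subtype
  have : Nonempty (X → E) := ⟨fun _ ↦ hne.some⟩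
  have huniq : ∀ s s' : B → E, Continuous s → Continuous s' → (∀ y, p (s y) = y) →
      (∀ y, p (s' y) = y) → ∀ y, s y = s' y → s = s' := fun s s' hs hs' h h' y hy ↦
    sep.eq_of_comp_eq hp.isLocallyInjective hs hs'
      (funext fun z ↦ (h z).trans (h' z).symm) y hy
  have hfib : ∀ i : p ⁻¹' {x}, ∃ s : B → E, Continuous s ∧ (∀ y, p (s y) = y) ∧
      s ⟨x, hx⟩ = i := by
    rintro ⟨e, rfl⟩
    exact hsec e hx
  choose s hs hps hsx using hfib
  have hopen : ∀ i, IsOpen (Set.range (s i)) := fun i ↦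
    (hp.isOpenEmbedding_of_comp (f := s i)
      (by rw [show p ∘ s i = Subtype.val from funext (hps i)]
          exact hB.isOpenEmbedding_subtypeVal) (hs i)).isOpen_range
  refine .of_trivialization (t := hB.trivializationDiscrete (fun i ↦ Set.range (s i)) B
    (fun i W hW ↦ ⟨fun h ↦ (h.preimage hp.continuous).inter (hopen i), fun h ↦ ?_⟩) ?_ ?_ ?_ ?_) hx
  · convert hp.isOpenMap _ h
    ext y
    refine ⟨fun hy ↦ ⟨s i ⟨y, hW hy⟩, ⟨?_, Set.mem_range_self _⟩, hps i _⟩, ?_⟩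
    · rw [Set.mem_preimage, hps]; exact hy
    · rintro ⟨z, hz, rfl⟩
      exact hz.1
  · rintro i _ ⟨y, rfl⟩ _ ⟨z, rfl⟩ h
    rw [hps, hps] at h
    rw [Subtype.ext h]
  · exact fun i y hy ↦ ⟨s i ⟨y, hy⟩, Set.mem_range_self _, hps i _⟩
  · refine fun i j hij ↦ Set.disjoint_left.2 ?_
    rintro _ ⟨y, rfl⟩ ⟨z, hz⟩
    obtain rfl : z = y := Subtype.ext (by rw [← hps j, hz, hps])
    refine hij (Subtype.ext ?_)
    rw [← hsx i, ← hsx j, huniq _ _ (hs i) (hs j) (hps i) (hps j) z hz.symm]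
  · intro e he
    obtain ⟨σ, hσ, hpσ, hσe⟩ := hsec e he
    refine Set.mem_iUnion.2 ⟨⟨σ ⟨x, hx⟩, hpσ _⟩, ⟨p e, he⟩, ?_⟩
    rw [huniq _ σ (hs _) hσ (hps _) hpσ ⟨x, hx⟩ (hsx _), hσe]

/-- Given path lifting, a separated local homeomorphism to an open subset `V` of a real normed space
has a section over every convex subset of `V` through every point above it. -/
theorem IsLocalHomeomorph.exists_section_of_convex {F : Type*} [NormedAddCommGroup F]
    [NormedSpace ℝ F] {V : Set F} {p : E → V} (hp : IsLocalHomeomorph p) (sep : IsSeparatedMap p)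
    (hlift : ∀ (γ : C(unitInterval, V)) (e : E), p e = γ 0 →
      ∃ Γ : C(unitInterval, E), Γ 0 = e ∧ p ∘ Γ = γ)
    {C : Set F} (hC : Convex ℝ C) (hCV : C ⊆ V) (e : E) (he : p e ∈ (Subtype.val ⁻¹' C : Set V)) :
    ∃ s : (Subtype.val ⁻¹' C : Set V) → E, Continuous s ∧ (∀ y, p (s y) = y) ∧
      s ⟨p e, he⟩ = e := by
  let B : Set V := Subtype.val ⁻¹' C
  let H : C(unitInterval × B, V) :=
    { toFun := fun ta ↦ ⟨AffineMap.lineMap (p e : F) (ta.2 : F) (ta.1 : ℝ),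
        hCV (hC.lineMap_mem he ta.2.2 ta.1.2)⟩
      continuous_toFun := by
        refine Continuous.subtype_mk ?_ _
        simp only [AffineMap.lineMap_apply_module]
        fun_prop }
  have hΓ : ∀ a : B, ∃ Γ : C(unitInterval, E), Γ 0 = e ∧ p ∘ Γ = fun t ↦ H (t, a) := fun a ↦
    hlift ⟨fun t ↦ H (t, a), by fun_prop⟩ e (by ext; simp [H])
  choose Γ h0 hΓ using hΓ
  have hcont : Continuous fun ta : unitInterval × B ↦ Γ ta.2 ta.1 :=
    hp.continuous_lift sep H (funext fun ta ↦ congr_fun (hΓ ta.2) ta.1)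
      (by simpa only [h0] using continuous_const) fun a ↦ (Γ a).continuous
  refine ⟨fun a ↦ Γ a 1, hcont.comp (.prodMk_right 1), fun y ↦ ?_, ?_⟩
  · exact (congr_fun (hΓ y) 1).trans (by ext; simp [H])
  · refine (sep.const_of_comp hp.isLocallyInjective (Γ ⟨p e, he⟩).continuous (fun t t' ↦ ?_)
      1 0).trans (h0 _)
    exact (congr_fun (hΓ _) t).trans ((by ext; simp [H]) : _ = _) |>.trans
      (congr_fun (hΓ _) t').symm

/-- A separated local homeomorphism with path lifting, from a nonempty space to a connected open
subset of a real normed space, is a surjective covering map. -/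
theorem IsLocalHomeomorph.isCoveringMap_and_surjective_of_path_lift {F : Type*}
    [NormedAddCommGroup F] [NormedSpace ℝ F] {V : Set F} (hV : IsOpen V) (hVc : IsPreconnected V)
    [Nonempty E] {p : E → V} (hp : IsLocalHomeomorph p) (sep : IsSeparatedMap p)
    (hlift : ∀ (γ : C(unitInterval, V)) (e : E), p e = γ 0 →
      ∃ Γ : C(unitInterval, E), Γ 0 = e ∧ p ∘ Γ = γ) :
    IsCoveringMap p ∧ Function.Surjective p := by
  have : PreconnectedSpace V := isPreconnected_iff_preconnectedSpace.1 hVc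
  have hball : ∀ x : V, ∃ r > 0, Metric.ball (x : F) r ⊆ V := fun x ↦
    Metric.isOpen_iff.1 hV x x.2
  have hsec := fun (x : F) (r : ℝ) (h : Metric.ball x r ⊆ V) ↦
    hp.exists_section_of_convex sep hlift (convex_ball x r) h
  have hopen (x : F) (r : ℝ) : IsOpen (Subtype.val ⁻¹' Metric.ball x r : Set V) :=
    Metric.isOpen_ball.preimage continuous_subtype_val
  have hsurj : Function.Surjective p := by
    refine Set.range_eq_univ.1 (IsClopen.eq_univ ⟨?_, hp.isOpenMap.isOpen_range⟩
      (Set.range_nonempty p))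
    refine isClosed_of_closure_subset fun x hx ↦ ?_
    obtain ⟨r, hr, hrV⟩ := hball x
    obtain ⟨_, hy, e, rfl⟩ := mem_closure_iff.1 hx _ (hopen x r) (Metric.mem_ball_self hr)
    obtain ⟨s, -, hps, -⟩ := hsec x r hrV e hy
    exact ⟨s ⟨x, Metric.mem_ball_self hr⟩, hps _⟩
  refine ⟨fun x ↦ ?_, hsurj⟩
  obtain ⟨r, hr, hrV⟩ := hball x
  refine hp.isEvenlyCovered_of_exists_section sep (hopen x r) ?_ (Metric.mem_ball_self hr)
    (hsurj x) (hsec x r hrV)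
  rw [← Topology.IsInducing.subtypeVal.isPreconnected_image, Subtype.image_preimage_coe,
    Set.inter_eq_right.2 hrV]
  exact (convex_ball _ _).isPreconnected

end LocalSections

/-- A holomorphic map between open sets without critical points is a local homeomorphism. -/
theorem isLocalHomeomorph_restrict_of_deriv_ne_zero {U V : Set ℂ} (hU : IsOpen U) (hV : IsOpen V)
    {f : ℂ → ℂ} (hf : DifferentiableOn ℂ f U) (hmaps : Set.MapsTo f U V)
    (hcrit : ∀ z ∈ U, deriv f z ≠ 0) : IsLocalHomeomorph (hmaps.restrict f U V) := by
  refine IsLocalHomeomorph.of_comp (g := Subtype.val) ?_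
    hV.isOpenEmbedding_subtypeVal.isLocalHomeomorph (hf.continuousOn.mapsToRestrict hmaps)
  have hfU : IsLocalHomeomorphOn f U := fun z hz ↦
    have h := (hf.analyticAt (hU.mem_nhds hz)).hasStrictDerivAt.hasStrictFDerivAt_equiv
      (hcrit z hz)
    ⟨h.toOpenPartialHomeomorph f, h.mem_toOpenPartialHomeomorph_source, rfl⟩
  exact isLocalHomeomorph_iff_isLocalHomeomorphOn_univ.2
    (hfU.comp hU.isOpenEmbedding_subtypeVal.isLocalHomeomorph.isLocalHomeomorphOn
      fun z _ ↦ z.2)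

/-- Hurwitz's theorem for plane domains: Let U, V ⊆ ℂ be nonempty open sets
with V connected, and f : U → V holomorphic with f′ ≠ 0 on U and no asymptotic curves (for
every escaping curve γ : [0,1) → U, the limit of f(γ(t)) as t → 1 does not exist in V).
Then f : U → V is a covering map (in particular a surjection). -/
theorem hurwitz_covering_theorem
    (U V : Set ℂ) (hUopen : IsOpen U) (hVopen : IsOpen V)
    (hUne : U.Nonempty) (hVconn : IsConnected V)
    (f : ℂ → ℂ) (hf : DifferentiableOn ℂ f U) (hmaps : Set.MapsTo f U V)
    (hcrit : ∀ z ∈ U, deriv f z ≠ 0)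
    (hasym : ∀ γ : ℝ → ℂ, ContinuousOn γ (Set.Ico 0 1) →
      Set.MapsTo γ (Set.Ico 0 1) U →
      (∀ K : Set ℂ, K ⊆ U → IsCompact K →
        ∃ t₀ ∈ Set.Ioo (0 : ℝ) 1, ∀ t ∈ Set.Ico t₀ 1, γ t ∉ K) →
      ¬ ∃ p ∈ V, Tendsto (fun t => f (γ t)) (nhdsWithin 1 (Set.Iio 1)) (nhds p)) :
    IsCoveringMap (Set.MapsTo.restrict f U V hmaps) ∧
    Function.Surjective (Set.MapsTo.restrict f U V hmaps) := by
  have hp := isLocalHomeomorph_restrict_of_deriv_ne_zero hUopen hVopen hf hmaps hcrit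
  have sep : IsSeparatedMap (hmaps.restrict f U V) := T2Space.isSeparatedMap _
  have : Nonempty U := hUne.to_subtype
  refine hp.isCoveringMap_and_surjective_of_path_lift hVopen hVconn.isPreconnected sep
    (hp.exists_path_lift_of_mapClusterPt sep fun Γ hΓ x hx ↦ ?_)
  by_contra! hno
  refine hasym (fun t ↦ Γ t) (continuous_subtype_val.comp_continuousOn hΓ) (fun t _ ↦ (Γ t).2)
    (fun K hKU hK ↦ ?_) ⟨x, x.2, (continuous_subtype_val.tendsto x).comp hx⟩
  have hK' : IsCompact (Subtype.val ⁻¹' K : Set U) :=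
    Topology.IsInducing.subtypeVal.isCompact_preimage' hK (by simpa using hKU)
  have hev : ∀ᶠ t in 𝓝[<] 1, (Γ t : ℂ) ∉ K := by
    by_contra hfreq
    obtain ⟨w, -, hw⟩ := hK'.exists_mapClusterPt_of_frequently (not_not.1 fun h ↦ hfreq
      (not_frequently.1 h))
    exact hno w hw
  obtain ⟨l, hl, hlK⟩ := mem_nhdsLT_iff_exists_Ico_subset.1 hev
  refine ⟨max l (1 / 2), ⟨by positivity, max_lt hl (by norm_num)⟩, fun t ht ↦
    hlK ⟨(le_max_left _ _).trans ht.1, ht.2⟩⟩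
end

section
/- Let D ⊆ ℂ be a domain and f : D → ℂ a harmonic map (a continuous function whose real and imaginary parts are harmonic on D). Suppose there exists m ∈ ℕ such that for every w ∈ ℂ the fiber f⁻¹(w) has at most m points. Then the set of points w ∈ ℂ such that f⁻¹(w) has exactly m points is open. -/
open Complex Topology

noncomputable section

/-- A real-valued function is harmonic on `D` if it is twice continuously differentiable there
and its Laplacian (the sum of the two pure second directional derivatives in the directions
`1` and `I`) vanishes on `D`. -/
def HarmonicOnSet (u : ℂ → ℝ) (D : Set ℂ) : Prop :=
  ContDiffOn ℝ 2 u D ∧ ∀ z ∈ D,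
    fderiv ℝ (fun w => fderiv ℝ u w 1) z 1 +
      fderiv ℝ (fun w => fderiv ℝ u w Complex.I) z Complex.I = 0

/-- An analytic function with nonzero value has an analytic `n`-th root. -/
theorem AnalyticAt.exists_pow_eq {G : ℂ → ℂ} {z₀ : ℂ} (hG : AnalyticAt ℂ G z₀) (h0 : G z₀ ≠ 0)
    {n : ℕ} (hn : n ≠ 0) :
    ∃ ρ : ℂ → ℂ, AnalyticAt ℂ ρ z₀ ∧ ρ z₀ ≠ 0 ∧ ∀ z, ρ z ^ n = G z := by
  obtain ⟨c, hc⟩ := IsAlgClosed.exists_pow_nat_eq (G z₀) (Nat.pos_of_ne_zero hn)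
  have hpow (z : ℂ) : (c * (G z / G z₀) ^ ((n : ℂ)⁻¹)) ^ n = G z := by
    rw [mul_pow, cpow_nat_inv_pow _ hn, hc, mul_div_cancel₀ _ h0]
  refine ⟨fun z => c * (G z / G z₀) ^ ((n : ℂ)⁻¹), ?_, fun h => h0 ?_, hpow⟩
  · refine analyticAt_const.mul ((hG.div analyticAt_const h0).cpow analyticAt_const ?_)
    simp [h0]
  · exact (hpow z₀).symm.trans ((congrArg (· ^ n) h).trans (zero_pow hn))

/-- Near a zero of order `n`, an analytic function is `w ↦ w ^ n` in a suitable coordinate. -/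
theorem AnalyticAt.exists_coordinate_eq_pow {F : ℂ → ℂ} {z₀ : ℂ} (hF : AnalyticAt ℂ F z₀)
    {n : ℕ} (hn : n ≠ 0) (hord : analyticOrderAt F z₀ = n) :
    ∃ ψ : ℂ → ℂ, ψ 0 = z₀ ∧ ∃ V ∈ 𝓝 (0 : ℂ), ContinuousOn ψ V ∧ Set.InjOn ψ V ∧
      ∀ w ∈ V, F (ψ w) = w ^ n := by
  obtain ⟨G, hG, hG0, hFG⟩ := hF.analyticOrderAt_eq_natCast.1 hord
  obtain ⟨ρ, hρ, hρ0, hρG⟩ := hG.exists_pow_eq hG0 hn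
  have hφ : HasStrictDerivAt (fun z => (z - z₀) * ρ z) (ρ z₀) z₀ := by
    have h : HasStrictDerivAt (fun z => z - z₀) 1 z₀ := (hasStrictDerivAt_id z₀).sub_const z₀
    exact (h.mul hρ.hasStrictDerivAt).congr_deriv (by simp)
  have hφ' := hφ.hasStrictFDerivAt_equiv hρ0
  set e := hφ'.toOpenPartialHomeomorph _
  have hez (z : ℂ) : e z = (z - z₀) * ρ z := rfl
  have he0 : e z₀ = 0 := by simp [hez]
  have hsource : z₀ ∈ e.source := hφ'.mem_toOpenPartialHomeomorph_source
  have htarget : (0 : ℂ) ∈ e.target := he0 ▸ e.map_source hsource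
  have hs0 : e.symm 0 = z₀ := by rw [← he0, e.left_inv hsource]
  have hcont : ContinuousAt e.symm 0 := e.continuousAt_symm htarget
  have hpre : ∀ᶠ w in 𝓝 (0 : ℂ), F (e.symm w) = (e.symm w - z₀) ^ n • G (e.symm w) :=
    hcont.eventually (p := fun z => F z = (z - z₀) ^ n • G z) (by rwa [hs0])
  refine ⟨e.symm, hs0, _, Filter.inter_mem (e.open_target.mem_nhds htarget) hpre,
    e.continuousOn_symm.mono Set.inter_subset_left,
    e.symm.injOn.mono Set.inter_subset_left, fun w hw => ?_⟩
  rw [hw.2, smul_eq_mul, ← hρG, ← mul_pow, ← hez, e.right_inv hw.1]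

/-- If `F` has order at least `q / 2` at `z₀`, then `q` essentially disjoint arcs on which `F` is
real emanate from `z₀`, inside any given neighbourhood. -/
theorem AnalyticAt.exists_arcs_im_eq_zero {F : ℂ → ℂ} {z₀ : ℂ} (hF : AnalyticAt ℂ F z₀) {q : ℕ}
    (hq : (q : ℕ∞) ≤ 2 * analyticOrderAt F z₀) {U : Set ℂ} (hU : U ∈ 𝓝 z₀) :
    ∃ γ : Fin q → ℝ → ℂ, (∀ k, γ k 0 = z₀) ∧ (∀ k, γ k 1 ≠ z₀) ∧
      (∀ k, ContinuousOn (γ k) (Set.Icc 0 1)) ∧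
      (∀ k, ∀ t ∈ Set.Icc (0 : ℝ) 1, γ k t ∈ U ∧ (F (γ k t)).im = 0) ∧
      ∀ k l, ∀ s ∈ Set.Ioc (0 : ℝ) 1, ∀ t ∈ Set.Ioc (0 : ℝ) 1, γ k s = γ l t → k = l := by
  rcases Nat.eq_zero_or_pos q with rfl | hq0
  · exact ⟨fun _ _ => 0, by simp⟩
  obtain ⟨n, hn, hqn, c, ψ, hψ0, V, hV, hcont, hinj, hFψ⟩ :
      ∃ n : ℕ, n ≠ 0 ∧ q ≤ 2 * n ∧ ∃ c : ℝ, ∃ ψ : ℂ → ℂ, ψ 0 = z₀ ∧ ∃ V ∈ 𝓝 (0 : ℂ),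
        ContinuousOn ψ V ∧ Set.InjOn ψ V ∧ ∀ w ∈ V, F (ψ w) = c * w ^ n := by
    rcases hord : analyticOrderAt F z₀ with _ | n
    · refine ⟨q, hq0.ne', by omega, 0, fun w => z₀ + w, by simp,
        {w | F (z₀ + w) = 0}, ?_, by fun_prop, fun a _ b _ h => by simpa using h,
        fun w hw => by simpa using hw⟩
      have h := analyticOrderAt_eq_top.1 hord
      have h2 : ContinuousAt (fun w : ℂ => z₀ + w) 0 := by fun_prop
      exact h2.eventually (by simpa using h)
    · have hqn : q ≤ 2 * n := by
        rw [hord, WithTop.some_eq_coe] at hq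
        change (q : ℕ∞) ≤ 2 * (n : ℕ∞) at hq
        exact_mod_cast hq
      have hn : n ≠ 0 := by omega
      obtain ⟨ψ, h0, V, hV, h1, h2, h3⟩ := hF.exists_coordinate_eq_pow hn hord
      exact ⟨n, hn, hqn, 1, ψ, h0, V, hV, h1, h2, by simpa using h3⟩
  have hψU : ∀ᶠ w in 𝓝 (0 : ℂ), w ∈ V ∧ ψ w ∈ U :=
    Filter.Eventually.and hV ((hcont.continuousAt hV).eventually (by rwa [hψ0]))
  obtain ⟨r, hr, hball⟩ := Metric.nhds_basis_closedBall.mem_iff.1 hψU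
  obtain ⟨ζ, hζ⟩ : ∃ ζ : ℂ, IsPrimitiveRoot ζ (2 * n) :=
    ⟨_, Complex.isPrimitiveRoot_exp _ (by omega)⟩
  have hζn : ζ ^ n = -1 := by
    have h1 : (ζ ^ n) ^ 2 = 1 := by rw [← pow_mul, mul_comm, hζ.pow_eq_one]
    rcases eq_or_eq_neg_of_sq_eq_sq _ 1 (h1.trans (one_pow 2).symm) with h | h
    · exact absurd h (hζ.pow_ne_one_of_pos_of_lt hn (by omega))
    · exact h
  have hζnorm : ‖ζ‖ = 1 := hζ.norm'_eq_one (by omega)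
  have hmem (k : ℕ) {t : ℝ} (ht : t ∈ Set.Icc (0 : ℝ) 1) :
      ((r * t : ℝ) : ℂ) * ζ ^ k ∈ V ∧ ψ (((r * t : ℝ) : ℂ) * ζ ^ k) ∈ U := by
    apply hball
    simp only [mem_closedBall_zero_iff, norm_mul, norm_pow, hζnorm, one_pow, mul_one, norm_real,
      Real.norm_eq_abs, abs_of_nonneg ht.1, abs_of_pos hr]
    nlinarith [ht.2]
  refine ⟨fun k t => ψ (((r * t : ℝ) : ℂ) * ζ ^ (k : ℕ)), fun k => by simp [hψ0], fun k h => ?_,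
    fun k => ?_, fun k t ht => ⟨(hmem k ht).2, ?_⟩, fun k l s hs t ht h => ?_⟩
  · have := hinj (hmem k (t := 1) (by simp)).1 (mem_of_mem_nhds hV) (h.trans hψ0.symm)
    exact hr.ne' (by simpa [hζ.ne_zero (by omega : 2 * n ≠ 0)] using this)
  · exact hcont.comp (by fun_prop) fun t ht => (hmem k ht).1
  · rw [hFψ _ (hmem k ht).1, mul_pow, ← pow_mul, mul_comm (k : ℕ), pow_mul, hζn]
    rcases neg_one_pow_eq_or ℂ (k : ℕ) with h | h <;> rw [h] <;> norm_cast
  · have h1 := hinj (hmem k ⟨hs.1.le, hs.2⟩).1 (hmem l ⟨ht.1.le, ht.2⟩).1 h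
    have h2 := congrArg norm h1
    simp only [norm_mul, norm_pow, hζnorm, one_pow, mul_one, norm_real,
      Real.norm_eq_abs, abs_of_pos hs.1, abs_of_pos ht.1, abs_of_pos hr] at h2
    rw [h2] at h1
    have h3 : ((r * t : ℝ) : ℂ) ≠ 0 := by exact_mod_cast (mul_pos hr ht.1).ne'
    exact Fin.ext (hζ.pow_inj (by omega) (by omega) (mul_left_cancel₀ h3 h1))

/-- If finitely many essentially disjoint arcs start in the fibre of `f` over `w₀` and `f` maps
them into a line, ending on the same side of `w₀`, then some fibre meets all of them. -/
theorem exists_card_le_encard_fiber_of_arcs {A : Type*} (T : Finset A) {γ : A → ℝ → ℂ} {f : ℂ → ℂ}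
    {D : Set ℂ} {w₀ c : ℂ} (hc : c ≠ 0) (hf : ContinuousOn f D)
    (hγ : ∀ a, ContinuousOn (γ a) (Set.Icc 0 1)) (hγD : ∀ a, Set.MapsTo (γ a) (Set.Icc 0 1) D)
    (hγ0 : ∀ a, f (γ a 0) = w₀)
    (him : ∀ a, ∀ t ∈ Set.Icc (0 : ℝ) 1, (c * (f (γ a t) - w₀)).im = 0)
    (hdisj : ∀ a b, ∀ s ∈ Set.Ioc (0 : ℝ) 1, ∀ t ∈ Set.Ioc (0 : ℝ) 1, γ a s = γ b t → a = b)
    (hpos : ∀ a ∈ T, 0 < (c * (f (γ a 1) - w₀)).re) :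
    ∃ w, (T.card : ℕ∞) ≤ (D ∩ f ⁻¹' {w}).encard := by
  rcases T.eq_empty_or_nonempty with rfl | hT
  · exact ⟨0, by simp⟩
  set ε := T.inf' hT fun a => (c * (f (γ a 1) - w₀)).re
  have hε0 : 0 < ε := (Finset.lt_inf'_iff hT).2 hpos
  have key (a : T) : ∃ t ∈ Set.Ioc (0 : ℝ) 1, (c * (f (γ a t) - w₀)).re = ε := by
    have hcont : ContinuousOn (fun t => (c * (f (γ a t) - w₀)).re) (Set.Icc 0 1) :=
      continuous_re.comp_continuousOn
        (continuousOn_const.mul ((hf.comp (hγ a) (hγD a)).sub continuousOn_const))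
    obtain ⟨t, ht, hte⟩ := intermediate_value_Icc zero_le_one hcont
      ⟨by simpa [hγ0] using hε0.le, Finset.inf'_le _ a.2⟩
    refine ⟨t, ⟨lt_of_le_of_ne ht.1 ?_, ht.2⟩, hte⟩
    rintro rfl
    simp only [hγ0, sub_self, mul_zero, zero_re] at hte
    exact hε0.ne hte
  choose t ht hte using key
  have hinj : Function.Injective fun a : T => γ a (t a) := fun a b h =>
    Subtype.ext (hdisj a b _ (ht a) _ (ht b) h)
  refine ⟨w₀ + ε / c, ?_⟩
  have hcard : (Set.range fun a : T => γ a (t a)).encard = T.card := by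
    rw [← Set.image_univ, hinj.encard_image, Set.encard_univ]
    simp
  rw [← hcard]
  refine Set.encard_le_encard (Set.range_subset_iff.2 fun a => ?_)
  have hta : t a ∈ Set.Icc (0 : ℝ) 1 := ⟨(ht a).1.le, (ht a).2⟩
  refine ⟨hγD a hta, ?_⟩
  have h : c * (f (γ a (t a)) - w₀) = ε :=
    Complex.ext (by simpa using hte a) (by simpa using him a _ hta)
  rw [Set.mem_preimage, Set.mem_singleton_iff, ← h]
  field_simp
  ring

/-- Suppose that near each point `z` of a finite fibre of `f`, a fixed linear functional of `f`
is the imaginary part of an analytic function `F z` of order at least `q z / 2` at `z`. Then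
some fibre has at least half of `∑ q z` points. -/
theorem exists_lt_encard_fiber {D : Set ℂ} (hD : IsOpen D) {f : ℂ → ℂ} (hf : ContinuousOn f D)
    {w₀ c : ℂ} (hc : c ≠ 0) (hS : (D ∩ f ⁻¹' {w₀}).Finite) {F : ℂ → ℂ → ℂ} {q : ℂ → ℕ}
    (hF : ∀ z ∈ D ∩ f ⁻¹' {w₀}, AnalyticAt ℂ (F z) z)
    (hFf : ∀ z ∈ D ∩ f ⁻¹' {w₀}, ∀ᶠ x in 𝓝 z, (F z x).im = (c * (f x - w₀)).im)
    (hq : ∀ z ∈ D ∩ f ⁻¹' {w₀}, (q z : ℕ∞) ≤ 2 * analyticOrderAt (F z) z)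
    {m : ℕ} (hm : 2 * m < ∑ z ∈ hS.toFinset, q z) :
    ∃ w, (m : ℕ∞) < (D ∩ f ⁻¹' {w}).encard := by
  classical
  set S := D ∩ f ⁻¹' {w₀}
  obtain ⟨U, hU, hUdisj⟩ := hS.t2_separation
  have hnhds (z : S) : {x | x ∈ U z ∧ x ∈ D ∧ (x ∈ S → x = z) ∧
      (F z x).im = (c * (f x - w₀)).im} ∈ 𝓝 (z : ℂ) := by
    filter_upwards [(hU z).2.mem_nhds (hU z).1, hD.mem_nhds z.2.1, hFf z z.2,
      (hS.subset Set.sdiff_subset : (S \ {(z : ℂ)}).Finite).isClosed.isOpen_compl.mem_nhds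
        (by simp : (z : ℂ) ∈ (S \ {(z : ℂ)})ᶜ)] with x h1 h2 h3 h4
    exact ⟨h1, h2, fun h => by_contra fun h' => h4 ⟨h, h'⟩, h3⟩
  choose γ hγ0 hγ1 hγc hγ hγdisj using fun z : S =>
    (hF z z.2).exists_arcs_im_eq_zero (hq z z.2) (hnhds z)
  have := hS.fintype
  let A := Σ z : S, Fin (q z)
  let Γ : A → ℝ → ℂ := fun a => γ a.1 a.2
  have hΓD (a : A) : Set.MapsTo (Γ a) (Set.Icc 0 1) D := fun t ht => (hγ a.1 a.2 t ht).1.2.1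
  have hΓ0 (a : A) : f (Γ a 0) = w₀ := by
    rw [show Γ a 0 = a.1 from hγ0 a.1 a.2]
    exact a.1.2.2
  have him (a : A) (t : ℝ) (ht : t ∈ Set.Icc (0 : ℝ) 1) : (c * (f (Γ a t) - w₀)).im = 0 := by
    have h := hγ a.1 a.2 t ht
    exact h.1.2.2.2.symm.trans h.2
  have hdisj (a b : A) (s : ℝ) (hs : s ∈ Set.Ioc (0 : ℝ) 1) (t : ℝ) (ht : t ∈ Set.Ioc (0 : ℝ) 1)
      (h : Γ a s = Γ b t) : a = b := by
    obtain ⟨z, k⟩ := a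
    obtain ⟨z', l⟩ := b
    have hz : z = z' := by
      refine Subtype.ext (hUdisj.elim_set z.2 z'.2 (Γ ⟨z, k⟩ s)
        (hγ z k s ⟨hs.1.le, hs.2⟩).1.1 ?_)
      rw [h]
      exact (hγ z' l t ⟨ht.1.le, ht.2⟩).1.1
    subst hz
    rw [hγdisj z k l s hs t ht h]
  have hne (a : A) : (c * (f (Γ a 1) - w₀)).re ≠ 0 := fun h => by
    have h1 : (1 : ℝ) ∈ Set.Icc (0 : ℝ) 1 := by simp
    have h0 : c * (f (Γ a 1) - w₀) = 0 := Complex.ext h (him a 1 h1)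
    refine hγ1 a.1 a.2 ((hγ a.1 a.2 1 h1).1.2.2.1 ⟨hΓD a h1, ?_⟩)
    exact sub_eq_zero.1 ((mul_eq_zero.1 h0).resolve_left hc)
  let P : Finset A := Finset.univ.filter fun a => 0 < (c * (f (Γ a 1) - w₀)).re
  let N : Finset A := Finset.univ.filter fun a => ¬ 0 < (c * (f (Γ a 1) - w₀)).re
  have hcard : P.card + N.card = ∑ z ∈ hS.toFinset, q z := by
    rw [Finset.card_filter_add_card_filter_not, Finset.card_univ, Fintype.card_sigma]
    simp only [Fintype.card_fin]
    rw [← Finset.sum_coe_sort hS.toFinset]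
    exact Fintype.sum_equiv (Equiv.subtypeEquivRight (by simp)) _ _ (fun _ => rfl)
  obtain ⟨w, hw⟩ := exists_card_le_encard_fiber_of_arcs P hc hf (fun a => hγc a.1 a.2) hΓD hΓ0 him
    hdisj fun a ha => (Finset.mem_filter.1 ha).2
  obtain ⟨w', hw'⟩ := exists_card_le_encard_fiber_of_arcs N (neg_ne_zero.2 hc) hf
    (fun a => hγc a.1 a.2) hΓD hΓ0 (fun a t ht => by rw [neg_mul, neg_im, him a t ht, neg_zero])
    hdisj fun a ha => by
      have h := (Finset.mem_filter.1 ha).2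
      rw [neg_mul, neg_re, neg_pos]
      exact lt_of_le_of_ne (not_lt.1 h) (hne a)
  rcases (by omega : m < P.card ∨ m < N.card) with h | h
  · exact ⟨w, lt_of_lt_of_le (by exact_mod_cast h) hw⟩
  · exact ⟨w', lt_of_lt_of_le (by exact_mod_cast h) hw'⟩

/-- A function harmonic at a zero `z` is, near `z`, the imaginary part of an analytic function
vanishing at `z`. -/
theorem InnerProductSpace.HarmonicAt.exists_analyticAt_im_eq {u : ℂ → ℝ} {z : ℂ}
    (hu : InnerProductSpace.HarmonicAt u z) (hz : u z = 0) :
    ∃ F : ℂ → ℂ, AnalyticAt ℂ F z ∧ F z = 0 ∧ ∀ᶠ x in 𝓝 z, (F x).im = u x := by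
  obtain ⟨R, hR, hball⟩ := Metric.nhds_basis_ball.mem_iff.1 hu.eventually
  obtain ⟨G, hG, hGu⟩ := InnerProductSpace.HarmonicOnNhd.exists_analyticOnNhd_ball_re_eq
    (fun x hx => hball hx : InnerProductSpace.HarmonicOnNhd u (Metric.ball z R))
  have hzm := Metric.mem_ball_self (x := z) hR
  refine ⟨fun x => I * (G x - G z), ?_, by simp, ?_⟩
  · exact analyticAt_const.mul ((hG z hzm).sub analyticAt_const)
  · filter_upwards [Metric.ball_mem_nhds z hR] with x hx
    have h1 : (G x).re = u x := hGu hx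
    have h2 : (G z).re = u z := hGu hzm
    simp [h1, h2, hz]

theorem AnalyticAt.deriv_eq_zero_of_hasFDerivAt_im {F : ℂ → ℂ} {z : ℂ} (hF : AnalyticAt ℂ F z)
    (h : HasFDerivAt (fun x => (F x).im) (0 : ℂ →L[ℝ] ℝ) z) : deriv F z = 0 := by
  have h1 : HasFDerivAt F _ z := hF.differentiableAt.hasDerivAt.hasFDerivAt.restrictScalars ℝ
  have h2 := h.unique (imCLM.hasFDerivAt.comp z h1)
  have h3 := DFunLike.congr_fun h2 1
  have h4 := DFunLike.congr_fun h2 I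
  apply Complex.ext
  · simpa using h4.symm
  · simpa using h3.symm

theorem HarmonicOnSet.harmonicAt {u : ℂ → ℝ} {D : Set ℂ} (hu : HarmonicOnSet u D) (hD : IsOpen D)
    {z : ℂ} (hz : z ∈ D) : InnerProductSpace.HarmonicAt u z := by
  refine ⟨hu.1.contDiffAt (hD.mem_nhds hz), ?_⟩
  filter_upwards [hD.mem_nhds hz] with x hx
  have h := hu.2 x hx
  have hd : DifferentiableAt ℝ (fderiv ℝ u) x :=
    ((hu.1.contDiffAt (hD.mem_nhds hx)).fderiv_right (m := 1) (by norm_num)).differentiableAt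
      (by norm_num)
  rw [fderiv_clm_apply hd (by fun_prop), fderiv_clm_apply hd (by fun_prop)] at h
  rw [InnerProductSpace.laplacian_eq_iteratedFDeriv_complexPlane]
  simpa [iteratedFDeriv_two_apply] using h

/-- A non-surjective real linear endomorphism of `ℂ` has range in a line `{w | Im (c * w) = 0}`. -/
theorem exists_im_mul_eq_zero_of_range_ne_top {L : ℂ →L[ℝ] ℂ} (hL : L.range ≠ ⊤) :
    ∃ c : ℂ, c ≠ 0 ∧ ∀ v, (c * L v).im = 0 := by
  obtain ⟨φ, hφ0, hφ⟩ := Submodule.exists_le_ker_of_lt_top _ (lt_top_iff_ne_top.2 hL)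
  have happ (w : ℂ) : φ w = ((⟨φ I, φ 1⟩ : ℂ) * w).im := by
    have hw : w = w.re • (1 : ℂ) + w.im • I := by simp
    conv_lhs => rw [hw, map_add, map_smul, map_smul]
    simp only [smul_eq_mul, mul_im]
    ring
  refine ⟨⟨φ I, φ 1⟩, fun h => hφ0 (LinearMap.ext fun w => by rw [happ, h]; simp), fun v => ?_⟩
  rw [← happ]
  exact hφ ⟨v, rfl⟩

/-- At every point of a fibre of maximal cardinality, a harmonic map has surjective derivative. -/
theorem range_eq_top_of_encard_fiber_eq {D : Set ℂ} (hD : IsOpen D) {f : ℂ → ℂ}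
    (hf : ContinuousOn f D) (hre : HarmonicOnSet (fun z => (f z).re) D)
    (him : HarmonicOnSet (fun z => (f z).im) D) {m : ℕ}
    (hm : ∀ w : ℂ, (D ∩ f ⁻¹' {w}).encard ≤ m) {w₀ : ℂ} (hw₀ : (D ∩ f ⁻¹' {w₀}).encard = m)
    {z₁ : ℂ} (hz₁ : z₁ ∈ D ∩ f ⁻¹' {w₀}) {L : ℂ →L[ℝ] ℂ} (hL : HasFDerivAt f L z₁) :
    L.range = ⊤ := by
  classical
  by_contra hrange
  obtain ⟨c, hc, hcL⟩ := exists_im_mul_eq_zero_of_range_ne_top hrange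
  have hS : (D ∩ f ⁻¹' {w₀}).Finite := Set.finite_of_encard_eq_coe hw₀
  have hharm (z : ℂ) (hz : z ∈ D ∩ f ⁻¹' {w₀}) :
      InnerProductSpace.HarmonicAt (fun x => (c * (f x - w₀)).im) z := by
    have h := (((him.harmonicAt hD hz.1).const_smul (c := c.re)).add
      ((hre.harmonicAt hD hz.1).const_smul (c := c.im))).sub
        (InnerProductSpace.harmonicAt_const (c * w₀).im)
    convert h using 1
    ext x
    simp [mul_im, mul_sub]
  have hex (z : ℂ) : ∃ F : ℂ → ℂ, z ∈ D ∩ f ⁻¹' {w₀} → AnalyticAt ℂ F z ∧ F z = 0 ∧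
      ∀ᶠ x in 𝓝 z, (F x).im = (c * (f x - w₀)).im := by
    by_cases hz : z ∈ D ∩ f ⁻¹' {w₀}
    · obtain ⟨F, hF⟩ := (hharm z hz).exists_analyticAt_im_eq (by simp [show f z = w₀ from hz.2])
      exact ⟨F, fun _ => hF⟩
    · exact ⟨0, fun h => absurd h hz⟩
  choose F hF using hex
  have hderiv : deriv (F z₁) z₁ = 0 := by
    refine (hF z₁ hz₁).1.deriv_eq_zero_of_hasFDerivAt_im ?_
    have h := imCLM.hasFDerivAt.comp z₁ ((hL.sub_const w₀).const_mul c)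
    have h0 : imCLM.comp (c • L) = 0 := by
      ext1 v
      exact hcL v
    rw [h0] at h
    exact h.congr_of_eventuallyEq (hF z₁ hz₁).2.2
  have hq : ∀ z ∈ D ∩ f ⁻¹' {w₀},
      ((if z = z₁ then 4 else 2 : ℕ) : ℕ∞) ≤ 2 * analyticOrderAt (F z) z := by
    intro z hz
    obtain ⟨hFz, hF0, -⟩ := hF z hz
    split_ifs with h
    · subst h
      have h2 : ((2 : ℕ) : ℕ∞) ≤ analyticOrderAt (F z) z := by
        rw [natCast_le_analyticOrderAt_iff_iteratedDeriv_eq_zero hFz]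
        intro i hi
        interval_cases i
        · simpa using hF0
        · simpa using hderiv
      calc ((4 : ℕ) : ℕ∞) = 2 * ((2 : ℕ) : ℕ∞) := by norm_num
        _ ≤ _ := by gcongr
    · have h1 : 1 ≤ analyticOrderAt (F z) z := by
        rw [Order.one_le_iff_ne_zero, Ne, analyticOrderAt_eq_zero]
        simp [hFz, hF0]
      calc ((2 : ℕ) : ℕ∞) = 2 * 1 := by norm_num
        _ ≤ _ := by gcongr
  have hsum : 2 * m < ∑ z ∈ hS.toFinset, if z = z₁ then 4 else 2 := by
    have hcard : hS.toFinset.card = m := by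
      rw [hS.encard_eq_coe_toFinset_card] at hw₀
      exact_mod_cast hw₀
    have h2 : ∑ z ∈ hS.toFinset, 2 < ∑ z ∈ hS.toFinset, if z = z₁ then 4 else 2 :=
      Finset.sum_lt_sum (fun z _ => by split_ifs <;> norm_num)
        ⟨z₁, hS.mem_toFinset.2 hz₁, by simp⟩
    rw [Finset.sum_const, hcard, smul_eq_mul] at h2
    omega
  obtain ⟨w, hw⟩ := exists_lt_encard_fiber hD hf hc hS (fun z hz => (hF z hz).1)
    (fun z hz => (hF z hz).2.2) hq hsum
  exact absurd (hm w) (not_le.2 hw)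

/-- If `f` is open at each point of a fibre with `m` points, then nearby fibres have at least `m`
points. -/
theorem eventually_le_encard_fiber {X Y : Type*} [TopologicalSpace X] [T2Space X]
    [TopologicalSpace Y] {D : Set X} (hD : IsOpen D) {f : X → Y} {w₀ : Y} {m : ℕ}
    (hw₀ : (D ∩ f ⁻¹' {w₀}).encard = m)
    (hopen : ∀ z ∈ D ∩ f ⁻¹' {w₀}, 𝓝 w₀ ≤ Filter.map f (𝓝 z)) :
    ∀ᶠ w in 𝓝 w₀, (m : ℕ∞) ≤ (D ∩ f ⁻¹' {w}).encard := by
  have hS : (D ∩ f ⁻¹' {w₀}).Finite := Set.finite_of_encard_eq_coe hw₀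
  obtain ⟨U, hU, hUdisj⟩ := hS.t2_separation
  have himage (z : X) (hz : z ∈ D ∩ f ⁻¹' {w₀}) : ∀ᶠ w in 𝓝 w₀, w ∈ f '' (U z ∩ D) :=
    hopen z hz (Filter.image_mem_map
      (Filter.inter_mem ((hU z).2.mem_nhds (hU z).1) (hD.mem_nhds hz.1)))
  filter_upwards [(Filter.eventually_all_finite hS).2 himage] with w hw
  choose! p hp hpw using hw
  have hinj : Set.InjOn p (D ∩ f ⁻¹' {w₀}) := fun a ha b hb h =>
    hUdisj.elim_set ha hb (p a) (hp a ha).1 (h ▸ (hp b hb).1)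
  rw [← hw₀, ← hinj.encard_image]
  exact Set.encard_le_encard (Set.image_subset_iff.2 fun z hz => ⟨(hp z hz).2, hpw z hz⟩)

/-- Let D ⊆ ℂ be a domain and f : D → ℂ a harmonic map (real and imaginary
parts harmonic on D). If there is m ∈ ℕ such that every w ∈ ℂ has at most m preimages in D,
then the set of w ∈ ℂ having exactly m preimages in D is open. -/
theorem harmonic_map_max_preimages_open
    (D : Set ℂ) (hDopen : IsOpen D) (hDconn : IsConnected D)
    (f : ℂ → ℂ) (hcont : ContinuousOn f D)
    (hre : HarmonicOnSet (fun z => (f z).re) D)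
    (him : HarmonicOnSet (fun z => (f z).im) D)
    (m : ℕ) (hm : ∀ w : ℂ, (D ∩ f ⁻¹' {w}).encard ≤ m) :
    IsOpen {w : ℂ | (D ∩ f ⁻¹' {w}).encard = m} := by
  rw [isOpen_iff_mem_nhds]
  intro w₀ hw₀
  have hopen (z : ℂ) (hz : z ∈ D ∩ f ⁻¹' {w₀}) : 𝓝 w₀ ≤ Filter.map f (𝓝 z) := by
    have hC : ContDiffAt ℝ 2 f z := by
      have h1 := ofRealCLM.contDiff.contDiffAt.comp z (hre.1.contDiffAt (hDopen.mem_nhds hz.1))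
      have h2 := ofRealCLM.contDiff.contDiffAt.comp z (him.1.contDiffAt (hDopen.mem_nhds hz.1))
      exact (h1.add (h2.mul (contDiffAt_const (c := I)))).congr_of_eventuallyEq
        (Filter.Eventually.of_forall fun x => (re_add_im (f x)).symm)
    have hL := hC.hasStrictFDerivAt (by norm_num)
    rw [hL.map_nhds_eq_of_surj
      (range_eq_top_of_encard_fiber_eq hDopen hcont hre him hm hw₀ hz hL.hasFDerivAt), hz.2]
  filter_upwards [eventually_le_encard_fiber hDopen hw₀ hopen] with w hw
  exact le_antisymm (hm w) hw
end
end
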